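/- (Partial isometry property of the minimal coupling operator.) The minimal coupling operator satisfies 𝒰 𝒰† = 𝒰† 𝒰 = Σ_{k ∈ B_p(Ĝ)} P(k); in particular, 𝒰 restricts to a unitary operator on the range of Σ_{k ∈ B_p(Ĝ)} P(k). -/

import Mathlib

open Finset

set_option linter.unusedSectionVars false

noncomputable section

/-- The Pontryagin dual `Ĝ = Hom(G, ℝ/2πℤ)` of an abelian group `G`,
where `ℝ/2πℤ` is `Real.Angle = AddCircle (2π)`. -/
abbrev PDual (G : Type) [AddCommGroup G] : Type := G →+ Real.Angle

/-- The dual of a finite abelian group is finite (hence all the `∑ᶠ` sums over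
(subsets of) chain groups with coefficients in `PDual G` below are honest
finite sums). -/
instance PDual.finite (G : Type) [AddCommGroup G] [Fintype G] : Finite (PDual G) := by
  classical
  set n := Fintype.card G with hn
  have hn0 : 0 < n := Fintype.card_pos
  haveI : Fact (0 < 2 * Real.pi) := ⟨by positivity⟩
  have hT0 : Set.Finite {θ : AddCircle (2 * Real.pi) | n • θ = 0} := by
    have hU : Set.Finite
        (⋃ d ∈ Finset.Icc 1 n, {θ : AddCircle (2 * Real.pi) | addOrderOf θ = d}) :=
      Set.Finite.biUnion (Finset.Icc 1 n).finite_toSet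
        (fun d hd => AddCircle.finite_setOf_addOrderOf_eq (2 * Real.pi)
          (by simp only [Finset.coe_Icc, Set.mem_Icc] at hd; exact hd.1))
    refine hU.subset ?_
    intro θ hθ
    have hfin : IsOfFinAddOrder θ := by
      rw [isOfFinAddOrder_iff_nsmul_eq_zero]
      exact ⟨n, hn0, hθ⟩
    have hdvd : addOrderOf θ ∣ n := addOrderOf_dvd_of_nsmul_eq_zero hθ
    have hpos : 0 < addOrderOf θ := hfin.addOrderOf_pos
    refine Set.mem_iUnion₂.mpr ⟨addOrderOf θ, ?_, rfl⟩
    simp only [Finset.mem_Icc]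
    exact ⟨hpos, Nat.le_of_dvd hn0 hdvd⟩
  have hT : Set.Finite {θ : Real.Angle | n • θ = 0} := hT0
  haveI : Finite {θ : Real.Angle | n • θ = 0} := hT.to_subtype
  have hinj : Function.Injective
      (fun (k : G →+ Real.Angle) (g : G) =>
        (⟨k g, by
          show n • k g = 0
          rw [← map_nsmul, card_nsmul_eq_zero, map_zero]⟩ :
          {θ : Real.Angle | n • θ = 0})) := by
    intro k₁ k₂ h
    ext g
    have := congrFun h g
    simpa [Subtype.ext_iff] using this
  exact Finite.of_injective _ hinj

/-- The well-defined complex exponential `e^{iθ} = cos θ + i sin θ` for `θ ∈ ℝ/2πℤ`. -/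
def expA (θ : Real.Angle) : ℂ := Real.Angle.cos θ + Real.Angle.sin θ * Complex.I

variable {G : Type} [AddCommGroup G] [Fintype G]

/-- The pairing `⟨k, φ⟩ = ∑_{σ ∈ Δ} k(σ)(φ(σ))` with values in `ℝ/2πℤ`. -/
def pairing {Δ : Type} [Fintype Δ] (k : Δ → PDual G) (φ : Δ → G) : Real.Angle :=
  ∑ σ, k σ (φ σ)

/-- The boundary map `∂`, `(∂k')(σ) = ∑_τ s(τ,σ) • k'(τ)`; its image is the
boundary group `B_p(Ĝ)` and its kernel the cycle group `Z_{p+1}(Ĝ)`. -/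
def bd {A B : Type} [Fintype A] (s : A → B → ℤ) (k' : A → PDual G) : B → PDual G :=
  fun σ => ∑ τ, s τ σ • k' τ

/-- The coboundary map `δ`, `(δφ)(τ) = ∑_σ s(τ,σ) • φ(σ)`; its kernel is the
cocycle group `Z^p(G)` and its image the coboundary group `B^{p+1}(G)`. -/
def cb {A B : Type} [Fintype B] (s : A → B → ℤ) (φ : B → G) : A → G :=
  fun τ => ∑ σ, s τ σ • φ σ

variable {H : Type} [NormedAddCommGroup H] [InnerProductSpace ℂ H]
  [FiniteDimensional ℂ H]

/-- The product of a pairwise-commuting finite family of operators. -/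
def commProd {ι : Type} [Fintype ι] (f : ι → H →L[ℂ] H)
    (h : ∀ i j, Commute (f i) (f j)) : H →L[ℂ] H :=
  Finset.univ.noncommProd f (fun a _ b _ _ => h a b)

variable {Δp Δp1 : Type} [Fintype Δp] [Fintype Δp1]

/-- `U(φ) = ∏_{σ ∈ Δ^p} U_σ(φ(σ))`. -/
def Uop (U : Δp → G → H →L[ℂ] H)
    (hU : ∀ σ σ' g g', Commute (U σ g) (U σ' g')) (φ : Δp → G) : H →L[ℂ] H :=
  commProd (fun σ => U σ (φ σ)) fun σ σ' => hU σ σ' _ _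

/-- The local factor `|G|⁻¹ ∑_{g ∈ G} e^{−i k(σ)(g)} U_σ(g)` of `P(k)`. -/
def Pfactor (U : Δp → G → H →L[ℂ] H) (k : Δp → PDual G) (σ : Δp) : H →L[ℂ] H :=
  (Fintype.card G : ℂ)⁻¹ • ∑ g : G, expA (-(k σ g)) • U σ g

theorem Pfactor_commute (U : Δp → G → H →L[ℂ] H)
    (hU : ∀ σ σ' g g', Commute (U σ g) (U σ' g')) (k : Δp → PDual G)
    (σ σ' : Δp) : Commute (Pfactor U k σ) (Pfactor U k σ') := by
  unfold Pfactor
  apply Commute.smul_left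
  apply Commute.smul_right
  apply Commute.sum_left
  intro g _
  apply Commute.sum_right
  intro g' _
  exact ((hU σ σ' g g').smul_right _).smul_left _

/-- The projector `P(k) = ∏_{σ ∈ Δ^p} ( |G|⁻¹ ∑_{g ∈ G} e^{−i k(σ)(g)} U_σ(g) )`. -/
def Pop (U : Δp → G → H →L[ℂ] H)
    (hU : ∀ σ σ' g g', Commute (U σ g) (U σ' g')) (k : Δp → PDual G) : H →L[ℂ] H :=
  commProd (Pfactor U k) (Pfactor_commute U hU k)

/-- `Ũ(k') = ∏_{τ ∈ Δ^{p+1}} Ũ_τ(k'(τ))`. -/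
def Utop (Ut : Δp1 → PDual G → H →L[ℂ] H)
    (hUt : ∀ τ τ' ρ ρ', Commute (Ut τ ρ) (Ut τ' ρ')) (k' : Δp1 → PDual G) : H →L[ℂ] H :=
  commProd (fun τ => Ut τ (k' τ)) fun τ τ' => hUt τ τ' _ _

/-- The minimal coupling operator `𝒰 = ∑_{k ∈ B_p(Ĝ)} P(k) Ũ(r(k))`, for a fixed
section `r` of the boundary map. -/
def MC (s : Δp1 → Δp → ℤ) (U : Δp → G → H →L[ℂ] H)
    (hU : ∀ σ σ' g g', Commute (U σ g) (U σ' g'))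
    (Ut : Δp1 → PDual G → H →L[ℂ] H)
    (hUt : ∀ τ τ' ρ ρ', Commute (Ut τ ρ) (Ut τ' ρ'))
    (r : (Δp → PDual G) → (Δp1 → PDual G)) : H →L[ℂ] H :=
  ∑ᶠ k ∈ Set.range (bd (G := G) s), Pop U hU k * Utop Ut hUt (r k)

theorem expA_eq (θ : Real.Angle) : expA θ = (Real.Angle.toCircle θ : ℂ) := by
  rw [Real.Angle.coe_toCircle]; rfl

theorem expA_add (a b : Real.Angle) : expA (a + b) = expA a * expA b := by
  simp [expA_eq, Real.Angle.toCircle_add]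

theorem expA_zero : expA 0 = 1 := by
  simp [expA_eq]

theorem star_expA (a : Real.Angle) : star (expA a) = expA (-a) := by
  rw [expA_eq, expA_eq, Real.Angle.toCircle_neg, Circle.coe_inv_eq_conj]
  rfl

theorem expA_eq_one {a : Real.Angle} (h : expA a = 1) : a = 0 := by
  rw [expA_eq] at h
  have h2 : Real.Angle.toCircle a = Real.Angle.toCircle 0 := by
    apply Subtype.ext
    rw [h]; simp
  have := congrArg (fun z : Circle => ((Complex.arg z : ℝ) : Real.Angle)) h2
  simpa using this

theorem sum_expA (k : PDual G) (hk : k ≠ 0) : ∑ g : G, expA (k g) = 0 := by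
  obtain ⟨g₀, hg₀⟩ : ∃ g, k g ≠ 0 := by
    by_contra! h
    exact hk (AddMonoidHom.ext h)
  have h1 : expA (k g₀) * ∑ g : G, expA (k g) = ∑ g : G, expA (k g) := by
    rw [Finset.mul_sum, ← Equiv.sum_comp (Equiv.addLeft g₀) (fun g => expA (k g))]
    simp [expA_add]
  have h2 : (expA (k g₀) - 1) * ∑ g : G, expA (k g) = 0 := by
    rw [sub_mul, h1]; simp
  rcases mul_eq_zero.mp h2 with h | h
  · exact absurd (expA_eq_one (sub_eq_zero.mp h)) hg₀
  · exact h

theorem Pfactor_star (U : Δp → G → H →L[ℂ] H)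
    (hUhom : ∀ σ g g', U σ (g + g') = U σ g * U σ g')
    (hU0 : ∀ σ, U σ 0 = 1)
    (hUunit : ∀ σ g, star (U σ g) * U σ g = 1 ∧ U σ g * star (U σ g) = 1)
    (k : Δp → PDual G) (σ : Δp) : star (Pfactor U k σ) = Pfactor U k σ := by
  have hs : ∀ g, star (U σ g) = U σ (-g) := fun g =>
    left_inv_eq_right_inv (hUunit σ g).1 (by rw [← hUhom, add_neg_cancel, hU0])
  unfold Pfactor
  rw [star_smul, star_sum]
  congr 1
  · simp
  · rw [← Equiv.sum_comp (Equiv.neg G) (fun g => expA (-(k σ g)) • U σ g)]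
    refine Finset.sum_congr rfl fun g _ => ?_
    rw [star_smul, star_expA, hs]
    simp

theorem U_mul_Pfactor (U : Δp → G → H →L[ℂ] H)
    (hUhom : ∀ σ g g', U σ (g + g') = U σ g * U σ g')
    (k : Δp → PDual G) (σ : Δp) (h : G) :
    U σ h * Pfactor U k σ = expA (k σ h) • Pfactor U k σ := by
  unfold Pfactor
  rw [mul_smul_comm, smul_comm]
  congr 1
  rw [Finset.mul_sum, Finset.smul_sum,
    ← Equiv.sum_comp (Equiv.addLeft h) (fun g => expA (k σ h) • expA (-(k σ g)) • U σ g)]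
  refine Finset.sum_congr rfl fun g _ => ?_
  rw [mul_smul_comm, smul_smul, ← expA_add]
  simp [hUhom]

theorem Pfactor_mul (U : Δp → G → H →L[ℂ] H)
    (hUhom : ∀ σ g g', U σ (g + g') = U σ g * U σ g')
    (k k' : Δp → PDual G) (σ : Δp) :
    Pfactor U k σ * Pfactor U k' σ
      = ((Fintype.card G : ℂ)⁻¹ * ∑ g, expA ((k' σ - k σ) g)) • Pfactor U k' σ := by
  conv_lhs => rw [Pfactor]
  rw [smul_mul_assoc, Finset.sum_mul, mul_smul, Finset.sum_smul]
  congr 1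
  refine Finset.sum_congr rfl fun g _ => ?_
  rw [smul_mul_assoc, U_mul_Pfactor U hUhom, smul_smul, ← expA_add]
  congr 2
  simp [sub_eq_add_neg, add_comm]

theorem Pfactor_mul_self (U : Δp → G → H →L[ℂ] H)
    (hUhom : ∀ σ g g', U σ (g + g') = U σ g * U σ g')
    (k : Δp → PDual G) (σ : Δp) :
    Pfactor U k σ * Pfactor U k σ = Pfactor U k σ := by
  rw [Pfactor_mul U hUhom]
  simp [expA_zero]

theorem Pfactor_mul_ne (U : Δp → G → H →L[ℂ] H)
    (hUhom : ∀ σ g g', U σ (g + g') = U σ g * U σ g')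
    (k k' : Δp → PDual G) (σ : Δp) (h : k σ ≠ k' σ) :
    Pfactor U k σ * Pfactor U k' σ = 0 := by
  rw [Pfactor_mul U hUhom, sum_expA _ (sub_ne_zero.mpr h.symm)]
  simp

theorem Pfactor_commute_of (U : Δp → G → H →L[ℂ] H) (T : H →L[ℂ] H) (σ : Δp)
    (hT : ∀ g, Commute (U σ g) T) (k : Δp → PDual G) : Commute (Pfactor U k σ) T := by
  unfold Pfactor
  apply Commute.smul_left
  apply Commute.sum_left
  intro g _
  exact (hT g).smul_left _

theorem noncommProd_star_aux {ι : Type} (f : ι → H →L[ℂ] H) (t : Finset ι)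
    (h : ∀ i j, Commute (f i) (f j)) (hs : ∀ i, star (f i) = f i)
    (hp : (t : Set ι).Pairwise (Function.onFun Commute f)) :
    star (t.noncommProd f hp) = t.noncommProd f hp := by
  classical
  induction t using Finset.induction_on with
  | empty => simp
  | insert a t ha ih =>
    rw [Finset.noncommProd_insert_of_notMem _ _ _ _ ha, star_mul, ih, hs]
    exact ((Finset.noncommProd_commute _ _ _ _ fun j _ => h a j).eq).symm

theorem commProd_star {ι : Type} [Fintype ι] (f : ι → H →L[ℂ] H)
    (h : ∀ i j, Commute (f i) (f j)) (hs : ∀ i, star (f i) = f i) :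
    star (commProd f h) = commProd f h :=
  noncommProd_star_aux f _ h hs _

theorem noncommProd_zero_aux {ι : Type} (f : ι → H →L[ℂ] H) (t : Finset ι)
    (hp : (t : Set ι).Pairwise (Function.onFun Commute f)) (i : ι) (hi : i ∈ t)
    (h0 : f i = 0) : t.noncommProd f hp = 0 := by
  classical
  rw [← Finset.mul_noncommProd_erase _ hi, h0, zero_mul]

theorem Pop_star (U : Δp → G → H →L[ℂ] H)
    (hU : ∀ σ σ' g g', Commute (U σ g) (U σ' g'))
    (hUhom : ∀ σ g g', U σ (g + g') = U σ g * U σ g')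
    (hU0 : ∀ σ, U σ 0 = 1)
    (hUunit : ∀ σ g, star (U σ g) * U σ g = 1 ∧ U σ g * star (U σ g) = 1)
    (k : Δp → PDual G) : star (Pop U hU k) = Pop U hU k :=
  commProd_star _ _ (Pfactor_star U hUhom hU0 hUunit k)

theorem Pfactor_commute₂ (U : Δp → G → H →L[ℂ] H)
    (hU : ∀ σ σ' g g', Commute (U σ g) (U σ' g')) (k k' : Δp → PDual G)
    (σ σ' : Δp) : Commute (Pfactor U k σ) (Pfactor U k' σ') :=
  Pfactor_commute_of U _ σ
    (fun g => (Pfactor_commute_of U _ σ' (fun g' => hU σ' σ g' g) k').symm) k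

theorem Pop_mul (U : Δp → G → H →L[ℂ] H)
    (hU : ∀ σ σ' g g', Commute (U σ g) (U σ' g'))
    (k k' : Δp → PDual G) :
    Pop U hU k * Pop U hU k' = commProd (Pfactor U k * Pfactor U k')
      (fun i j => by
        have := Pfactor_commute₂ U hU
        exact ((this k k i j).mul_right (this k k' i j)).mul_left
          ((this k' k i j).mul_right (this k' k' i j))) := by
  unfold Pop commProd
  exact (Finset.noncommProd_mul_distrib _ _ _ _
    (fun a _ b _ _ => Pfactor_commute₂ U hU k' k a b)).symm

theorem Pop_mul_self (U : Δp → G → H →L[ℂ] H)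
    (hU : ∀ σ σ' g g', Commute (U σ g) (U σ' g'))
    (hUhom : ∀ σ g g', U σ (g + g') = U σ g * U σ g')
    (k : Δp → PDual G) : Pop U hU k * Pop U hU k = Pop U hU k := by
  rw [Pop_mul]
  have : Pfactor U k * Pfactor U k = Pfactor U k :=
    funext fun σ => Pfactor_mul_self U hUhom k σ
  simp only [this]
  rfl

theorem Pop_mul_ne (U : Δp → G → H →L[ℂ] H)
    (hU : ∀ σ σ' g g', Commute (U σ g) (U σ' g'))
    (hUhom : ∀ σ g g', U σ (g + g') = U σ g * U σ g')
    (k k' : Δp → PDual G) (h : k ≠ k') : Pop U hU k * Pop U hU k' = 0 := by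
  classical
  obtain ⟨σ, hσ⟩ := Function.ne_iff.mp h
  rw [Pop_mul]
  exact noncommProd_zero_aux _ _ _ σ (Finset.mem_univ σ) (Pfactor_mul_ne U hUhom k k' σ hσ)

theorem Utop_unitary (Ut : Δp1 → PDual G → H →L[ℂ] H)
    (hUt : ∀ τ τ' ρ ρ', Commute (Ut τ ρ) (Ut τ' ρ'))
    (hUtunit : ∀ τ ρ, star (Ut τ ρ) * Ut τ ρ = 1 ∧ Ut τ ρ * star (Ut τ ρ) = 1)
    (k' : Δp1 → PDual G) : Utop Ut hUt k' ∈ unitary (H →L[ℂ] H) := by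
  unfold Utop commProd
  exact Finset.noncommProd_induction _ _ _ (fun x => x ∈ unitary (H →L[ℂ] H))
    (fun a b ha hb => mul_mem ha hb) (one_mem _) (fun τ _ => hUtunit τ _)

theorem Pop_commute_Utop (U : Δp → G → H →L[ℂ] H)
    (hU : ∀ σ σ' g g', Commute (U σ g) (U σ' g'))
    (Ut : Δp1 → PDual G → H →L[ℂ] H)
    (hUt : ∀ τ τ' ρ ρ', Commute (Ut τ ρ) (Ut τ' ρ'))
    (hmix : ∀ σ τ g ρ, Commute (U σ g) (Ut τ ρ))
    (k : Δp → PDual G) (k' : Δp1 → PDual G) :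
    Commute (Pop U hU k) (Utop Ut hUt k') := by
  unfold Pop Utop commProd
  refine Finset.noncommProd_commute _ _ _ _ fun τ _ => ?_
  refine (Finset.noncommProd_commute _ _ _ _ fun σ _ => ?_).symm
  exact (Pfactor_commute_of U _ σ (fun g => hmix σ τ g _) k).symm

/-- Abstract form of the partial isometry property. -/
theorem sum_partial_isometry {R ι : Type} [Ring R] [StarRing R] (S : Finset ι)
    (P V : ι → R) (hP : ∀ k, star (P k) = P k) (hPP : ∀ k, P k * P k = P k)
    (hne : ∀ k l, k ≠ l → P k * P l = 0) (hV : ∀ k, V k ∈ unitary R)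
    (hc : ∀ k l, Commute (P k) (V l)) :
    (∑ k ∈ S, P k * V k) * star (∑ k ∈ S, P k * V k) = ∑ k ∈ S, P k ∧
    star (∑ k ∈ S, P k * V k) * (∑ k ∈ S, P k * V k) = ∑ k ∈ S, P k := by
  classical
  have hc' : ∀ k l, P k * star (V l) = star (V l) * P k := fun k l => by
    have := (hc k l).star_star.eq
    rwa [hP] at this
  constructor
  · rw [star_sum, Finset.sum_mul]
    refine Finset.sum_congr rfl fun k hk => ?_
    rw [Finset.mul_sum, Finset.sum_eq_single_of_mem k hk]
    · rw [star_mul, hP, ← hc', mul_assoc, ← mul_assoc (V k), ← (hc k k).eq, mul_assoc,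
        (hV k).2, mul_one, hPP]
    · intro l _ hl
      rw [star_mul, hP, ← hc', mul_assoc, ← mul_assoc (V k), ← (hc l k).eq, mul_assoc,
        ← mul_assoc, hne k l hl.symm, zero_mul]
  · rw [star_sum, Finset.sum_mul]
    refine Finset.sum_congr rfl fun k hk => ?_
    rw [Finset.mul_sum, Finset.sum_eq_single_of_mem k hk]
    · rw [star_mul, hP, mul_assoc, ← mul_assoc (P k), hPP, (hc k k).eq, ← mul_assoc,
        (hV k).1, one_mul]
    · intro l _ hl
      rw [star_mul, hP, mul_assoc, ← mul_assoc (P k), hne k l hl.symm, zero_mul, mul_zero]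

/-- **Partial isometry property of the minimal coupling operator**:
`𝒰 𝒰† = 𝒰† 𝒰 = ∑_{k ∈ B_p(Ĝ)} P(k)`; in particular `𝒰` restricts to a
unitary operator on the range of `∑_{k ∈ B_p(Ĝ)} P(k)`. -/
theorem minimal_coupling_partial_isometry
    (s : Δp1 → Δp → ℤ)
    (U : Δp → G → H →L[ℂ] H)
    (hU : ∀ σ σ' g g', Commute (U σ g) (U σ' g'))
    (hUhom : ∀ σ g g', U σ (g + g') = U σ g * U σ g')
    (hU0 : ∀ σ, U σ 0 = 1)
    (hUunit : ∀ σ g, star (U σ g) * U σ g = 1 ∧ U σ g * star (U σ g) = 1)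
    (Ut : Δp1 → PDual G → H →L[ℂ] H)
    (hUt : ∀ τ τ' ρ ρ', Commute (Ut τ ρ) (Ut τ' ρ'))
    (hUthom : ∀ τ ρ ρ', Ut τ (ρ + ρ') = Ut τ ρ * Ut τ ρ')
    (hUt0 : ∀ τ, Ut τ 0 = 1)
    (hUtunit : ∀ τ ρ, star (Ut τ ρ) * Ut τ ρ = 1 ∧ Ut τ ρ * star (Ut τ ρ) = 1)
    (hmix : ∀ σ τ g ρ, Commute (U σ g) (Ut τ ρ))
    (r : (Δp → PDual G) → (Δp1 → PDual G))
    (hr : ∀ k ∈ Set.range (bd (G := G) s), bd s (r k) = k) :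
    MC s U hU Ut hUt r * star (MC s U hU Ut hUt r)
        = (∑ᶠ k ∈ Set.range (bd (G := G) s), Pop U hU k) ∧
    star (MC s U hU Ut hUt r) * MC s U hU Ut hUt r
        = (∑ᶠ k ∈ Set.range (bd (G := G) s), Pop U hU k) := by
  have hfin : (Set.range (bd (G := G) s)).Finite := Set.toFinite _
  unfold MC
  rw [finsum_mem_eq_finite_toFinset_sum _ hfin, finsum_mem_eq_finite_toFinset_sum _ hfin]
  exact sum_partial_isometry hfin.toFinset (Pop U hU) (fun k => Utop Ut hUt (r k))
    (Pop_star U hU hUhom hU0 hUunit) (Pop_mul_self U hU hUhom) (Pop_mul_ne U hU hUhom)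
    (fun k => Utop_unitary Ut hUt hUtunit (r k))
    (fun k l => Pop_commute_Utop U hU Ut hUt hmix k (r l))
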